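/- arXiv:2511.02317 — 5 statements merged into one kernel-verified Lean document; each statement's English description precedes it below -/
import Mathlib

section
/- Let G be a finite connected simple graph on a vertex set V with at least two vertices, and let V_ℓ ⊆ V be a nonempty set of leader nodes. Then the smallest eigenvalue λ_F of the grounded Laplacian L̄ = L + E is a simple eigenvalue: the eigenspace of L̄ associated with λ_F is one-dimensional. -/
open Matrix

lemma aux_abs_ker {V : Type*} [Fintype V] [DecidableEq V] (M : Matrix V V ℝ)
    (hM : M.PosSemidef) (hoff : ∀ i j, i ≠ j → M i j ≤ 0) (w : V → ℝ) (hw : M *ᵥ w = 0) :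
    M *ᵥ (fun i => |w i|) = 0 := by
  have h1 := hM.dotProduct_mulVec_zero_iff (fun i => |w i|)
  rw [← h1]
  apply le_antisymm
  · have h2 : w ⬝ᵥ (M *ᵥ w) = 0 := by rw [hw]; simp
    rw [← h2]
    simp only [dotProduct, mulVec, Finset.mul_sum, star_trivial]
    refine Finset.sum_le_sum fun i _ => Finset.sum_le_sum fun j _ => ?_
    by_cases h : i = j
    · subst h
      have := abs_mul_abs_self (w i)
      apply le_of_eq
      linear_combination (M i i) * this
    · have h3 := hoff i j h
      have h4 : w i * w j ≤ |w i| * |w j| := by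
        rw [← abs_mul]; exact le_abs_self _
      nlinarith [mul_le_mul_of_nonpos_left h4 h3]
  · exact hM.dotProduct_mulVec_nonneg _

lemma aux_psd {V : Type*} [Fintype V] [DecidableEq V] (M : Matrix V V ℝ)
    (hM : M.IsHermitian) (h : ∀ μ : ℝ, (∃ w : V → ℝ, w ≠ 0 ∧ M *ᵥ w = μ • w) → 0 ≤ μ) :
    M.PosSemidef := by
  rw [hM.posSemidef_iff_eigenvalues_nonneg]
  intro i
  refine h _ ⟨_, ?_, hM.mulVec_eigenvectorBasis i⟩
  intro h0
  apply hM.eigenvectorBasis.orthonormal.ne_zero i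
  ext j
  exact congrFun h0 j

/-- For a finite connected simple graph on at least two vertices with a
nonempty leader set, the smallest eigenvalue `λF` of the grounded Laplacian
`L̄ = L + E` is simple: its eigenspace is one-dimensional. -/
theorem grounded_laplacian_smallest_eigenvalue_simple
    {V : Type*} [Fintype V] [DecidableEq V]
    (G : SimpleGraph V) [DecidableRel G.Adj]
    (hconn : G.Connected) (hcard : 2 ≤ Fintype.card V)
    (Vl : Finset V) (hVl : Vl.Nonempty)
    (Lbar : Matrix V V ℝ)
    (hLbar : Lbar = G.lapMatrix ℝ +
        Matrix.diagonal (fun i => if i ∈ Vl then (1 : ℝ) else 0))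
    (lamF : ℝ)
    (hEig : ∃ w : V → ℝ, w ≠ 0 ∧ Lbar *ᵥ w = lamF • w)
    (hMin : ∀ μ : ℝ, (∃ w : V → ℝ, w ≠ 0 ∧ Lbar *ᵥ w = μ • w) → lamF ≤ μ) :
    Module.finrank ℝ (Module.End.eigenspace (Matrix.toLin' Lbar) lamF) = 1 := by
  classical
  set M : Matrix V V ℝ := Lbar - lamF • (1 : Matrix V V ℝ) with hMdef
  have hmul : ∀ w : V → ℝ, M *ᵥ w = Lbar *ᵥ w - lamF • w := by
    intro w
    rw [hMdef, sub_mulVec, smul_mulVec, one_mulVec]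
  have hherm : M.IsHermitian := by
    have h1 : Lbar.IsHermitian := by
      rw [hLbar]
      exact (G.isHermitian_lapMatrix ℝ).add (isHermitian_diagonal _)
    refine h1.sub ?_
    rw [smul_one_eq_diagonal]
    exact isHermitian_diagonal _
  have hpsd : M.PosSemidef := by
    apply aux_psd M hherm
    rintro μ ⟨w, hw0, hw⟩
    have := hMin (lamF + μ) ⟨w, hw0, by
      rw [hmul] at hw
      rw [add_smul, ← hw]; abel⟩
    linarith
  have hoffeq : ∀ i j, i ≠ j → M i j = - (if G.Adj i j then 1 else 0) := by
    intro i j hij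
    simp [hMdef, hLbar, SimpleGraph.lapMatrix, SimpleGraph.degMatrix, hij, SimpleGraph.adjMatrix_apply]
  have hoff : ∀ i j, i ≠ j → M i j ≤ 0 := by
    intro i j hij
    rw [hoffeq i j hij]
    split_ifs <;> norm_num
  have hvan : ∀ w : V → ℝ, M *ᵥ w = 0 → ∀ v, w v = 0 → w = 0 := by
    intro w hw v hv
    have habs := aux_abs_ker M hpsd hoff w hw
    have hstep : ∀ a b, G.Adj a b → w a = 0 → w b = 0 := by
      intro a b hab ha
      have h1 := congrFun habs a
      simp only [mulVec, dotProduct, Pi.zero_apply] at h1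
      have h2 : ∀ j ∈ Finset.univ, M a j * |w j| ≤ 0 := by
        intro j _
        by_cases h : a = j
        · subst h; simp [ha]
        · exact mul_nonpos_of_nonpos_of_nonneg (hoff a j h) (abs_nonneg _)
      have h3 := (Finset.sum_eq_zero_iff_of_nonpos h2).1 h1 b (Finset.mem_univ _)
      rw [hoffeq a b hab.ne] at h3
      simpa [hab] using h3
    ext u
    obtain ⟨p⟩ := hconn.preconnected v u
    induction p with
    | nil => exact hv
    | cons hadj p ih => exact ih (hstep _ _ hadj hv)
  obtain ⟨w, hw0, hw⟩ := hEig
  have hwM : M *ᵥ w = 0 := by rw [hmul, hw, sub_self]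
  obtain ⟨v⟩ := hconn.nonempty
  have hwv : w v ≠ 0 := fun h => hw0 (hvan w hwM v h)
  have hmem : w ∈ Module.End.eigenspace (Matrix.toLin' Lbar) lamF := by
    rw [Module.End.mem_eigenspace_iff, toLin'_apply, hw]
  rw [finrank_eq_one_iff']
  refine ⟨⟨w, hmem⟩, fun h => hw0 (congrArg Subtype.val h), ?_⟩
  rintro ⟨u, hu⟩
  refine ⟨u v / w v, Subtype.ext ?_⟩
  rw [Module.End.mem_eigenspace_iff, toLin'_apply] at hu
  have huM : M *ᵥ u = 0 := by rw [hmul, hu, sub_self]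
  have := hvan ((u v / w v) • w - u) (by
    rw [mulVec_sub, mulVec_smul, hwM, huM]; simp) v (by
    simp [hwv])
  exact sub_eq_zero.1 this
end

section
/- Let G be a finite connected simple graph on a vertex set V, and let V_ℓ ⊆ V be a set of leader nodes such that both V_ℓ and the follower set V_f = V \ V_ℓ are nonempty. Then the smallest eigenvalue λ_F of the grounded Laplacian L̄ = L + E satisfies 0 < λ_F < 1. -/
open Matrix

/-- For a finite connected simple graph with nonempty leader set and
nonempty follower set, the smallest eigenvalue `λF` of the grounded Laplacian
`L̄ = L + E` satisfies `0 < λF < 1`. -/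
theorem grounded_laplacian_smallest_eigenvalue_in_unit_interval
    {V : Type*} [Fintype V] [DecidableEq V]
    (G : SimpleGraph V) [DecidableRel G.Adj]
    (hconn : G.Connected)
    (Vl : Finset V) (hVl : Vl.Nonempty) (hVf : ∃ i, i ∉ Vl)
    (Lbar : Matrix V V ℝ)
    (hLbar : Lbar = G.lapMatrix ℝ +
        Matrix.diagonal (fun i => if i ∈ Vl then (1 : ℝ) else 0))
    (lamF : ℝ)
    (hEig : ∃ w : V → ℝ, w ≠ 0 ∧ Lbar *ᵥ w = lamF • w)
    (hMin : ∀ μ : ℝ, (∃ w : V → ℝ, w ≠ 0 ∧ Lbar *ᵥ w = μ • w) → lamF ≤ μ) :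
    0 < lamF ∧ lamF < 1 := by
  have hmul : ∀ (w : V → ℝ) (i : V), (Lbar *ᵥ w) i =
      (G.lapMatrix ℝ *ᵥ w) i + (if i ∈ Vl then (1 : ℝ) else 0) * w i := by
    intro w i
    rw [hLbar, Matrix.add_mulVec, Pi.add_apply, Matrix.mulVec_diagonal]
  constructor
  · obtain ⟨w, hw0, hw⟩ := hEig
    by_contra hneg
    have hneg' : lamF ≤ 0 := not_lt.mp hneg
    have hL : 0 ≤ w ⬝ᵥ (G.lapMatrix ℝ *ᵥ w) := by
      have h := (SimpleGraph.posSemidef_lapMatrix ℝ G).dotProduct_mulVec_nonneg w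
      simpa using h
    have hterm : ∀ i ∈ Finset.univ, 0 ≤ w i * ((if i ∈ Vl then (1 : ℝ) else 0) * w i) := by
      intro i _
      split_ifs
      · nlinarith [mul_self_nonneg (w i)]
      · simp
    have hE := Finset.sum_nonneg hterm
    have hsum : w ⬝ᵥ (Lbar *ᵥ w) = w ⬝ᵥ (G.lapMatrix ℝ *ᵥ w) +
        ∑ i, w i * ((if i ∈ Vl then (1 : ℝ) else 0) * w i) := by
      simp only [dotProduct, hmul, mul_add, Finset.sum_add_distrib]
    have hww : 0 ≤ w ⬝ᵥ w := Finset.sum_nonneg fun i _ => mul_self_nonneg (w i)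
    have hle : w ⬝ᵥ (Lbar *ᵥ w) ≤ 0 := by
      rw [hw, dotProduct_smul, smul_eq_mul]
      exact mul_nonpos_of_nonpos_of_nonneg hneg' hww
    have hL0 : w ⬝ᵥ (G.lapMatrix ℝ *ᵥ w) = 0 := by linarith
    have hE0 : ∑ i, w i * ((if i ∈ Vl then (1 : ℝ) else 0) * w i) = 0 := by linarith
    have hconst : ∀ i j : V, G.Reachable i j → w i = w j := by
      rw [← SimpleGraph.lapMatrix_toLinearMap₂'_apply'_eq_zero_iff_forall_reachable,
        Matrix.toLinearMap₂'_apply']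
      exact hL0
    obtain ⟨l, hl⟩ := hVl
    have hl0 : w l = 0 := by
      have h := (Finset.sum_eq_zero_iff_of_nonneg hterm).mp hE0 l (Finset.mem_univ l)
      simpa [hl] using h
    apply hw0
    funext i
    rw [hconst i l (hconn.preconnected i l), hl0, Pi.zero_apply]
  · by_contra hge
    have hge' : 1 ≤ lamF := not_lt.mp hge
    have hB : (Lbar - 1).IsHermitian := by
      rw [hLbar]
      exact ((SimpleGraph.isHermitian_lapMatrix ℝ G).add
        (Matrix.isHermitian_diagonal _)).sub Matrix.isHermitian_one
    have hpsd : (Lbar - 1).PosSemidef := by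
      rw [hB.posSemidef_iff_eigenvalues_nonneg]
      intro i
      have h := hB.mulVec_eigenvectorBasis i
      have hne : (hB.eigenvectorBasis i).ofLp ≠ 0 := by
        intro h0
        apply hB.eigenvectorBasis.toBasis.ne_zero i
        ext j
        simpa using congrFun h0 j
      have h2 := hMin (hB.eigenvalues i + 1) ⟨_, hne, by
        rw [Matrix.sub_mulVec, Matrix.one_mulVec, sub_eq_iff_eq_add] at h
        rw [h, add_smul, one_smul]⟩
      show (0 : ℝ) ≤ hB.eigenvalues i
      linarith
    have h := hpsd.dotProduct_mulVec_nonneg (fun _ => (1 : ℝ))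
    have hone : G.lapMatrix ℝ *ᵥ (fun _ => (1 : ℝ)) = 0 :=
      (SimpleGraph.lapMatrix_mulVec_eq_zero_iff_forall_adj G).mpr fun _ _ _ => rfl
    have hlt : ∑ i : V, ((if i ∈ Vl then (1 : ℝ) else 0) - 1) < 0 := by
      obtain ⟨f, hf⟩ := hVf
      refine Finset.sum_neg' ?_ ⟨f, Finset.mem_univ f, ?_⟩
      · intro i _
        split_ifs <;> norm_num
      · simp [hf]
    have heq : star (fun _ : V => (1 : ℝ)) ⬝ᵥ ((Lbar - 1) *ᵥ (fun _ => (1 : ℝ))) =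
        ∑ i : V, ((if i ∈ Vl then (1 : ℝ) else 0) - 1) := by
      simp only [dotProduct, Matrix.sub_mulVec, Matrix.one_mulVec, Pi.sub_apply, hmul, hone,
        Pi.star_apply, star_trivial, Pi.zero_apply, zero_add, mul_one, one_mul]
    rw [heq] at h
    linarith
end

section
/- Let G be a finite connected simple graph on a vertex set V, and let V_ℓ ⊆ V be a set of leader nodes. Then there exists an eigenvector v of the grounded Laplacian L̄ = L + E associated with its smallest eigenvalue λ_F all of whose entries are strictly positive. -/
open Matrix

/-- For a finite connected simple graph with leader set `Vl`, there is
an eigenvector of the grounded Laplacian `L̄ = L + E` associated with its smallest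
eigenvalue `λF` all of whose entries are strictly positive. -/
theorem grounded_laplacian_positive_fiedler_vector
    {V : Type*} [Fintype V] [DecidableEq V]
    (G : SimpleGraph V) [DecidableRel G.Adj]
    (hconn : G.Connected)
    (Vl : Finset V)
    (Lbar : Matrix V V ℝ)
    (hLbar : Lbar = G.lapMatrix ℝ +
        Matrix.diagonal (fun i => if i ∈ Vl then (1 : ℝ) else 0))
    (lamF : ℝ)
    (hEig : ∃ w : V → ℝ, w ≠ 0 ∧ Lbar *ᵥ w = lamF • w)
    (hMin : ∀ μ : ℝ, (∃ w : V → ℝ, w ≠ 0 ∧ Lbar *ᵥ w = μ • w) → lamF ≤ μ) :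
    ∃ v : V → ℝ, (∀ i, 0 < v i) ∧ Lbar *ᵥ v = lamF • v := by
  classical
  obtain ⟨w, hw0, hw⟩ := hEig
  set B : Matrix V V ℝ := Lbar - lamF • (1 : Matrix V V ℝ) with hB
  have hBv : ∀ x : V → ℝ, B *ᵥ x = Lbar *ᵥ x - lamF • x := by
    intro x
    rw [hB, Matrix.sub_mulVec, Matrix.smul_mulVec, Matrix.one_mulVec]
  have hLH : Lbar.IsHermitian := by
    rw [hLbar]
    exact (G.isHermitian_lapMatrix ℝ).add (Matrix.isHermitian_diagonal _)
  have hBH : B.IsHermitian := by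
    refine hLH.sub ?_
    ext i j
    simp [Matrix.one_apply, eq_comm]
  have hPSD : B.PosSemidef := by
    rw [hBH.posSemidef_iff_eigenvalues_nonneg]
    intro i
    have h1 := hBH.mulVec_eigenvectorBasis i
    have h2 := hMin (hBH.eigenvalues i + lamF) ⟨(hBH.eigenvectorBasis i).ofLp, ?_, ?_⟩
    · simpa using h2
    · intro h
      have := hBH.eigenvectorBasis.orthonormal.ne_zero i
      exact this (by ext j; exact congrFun h j)
    · rw [hBv] at h1
      rw [add_smul, ← h1]
      simp
  have hoff : ∀ i j, i ≠ j → B i j = - (if G.Adj i j then 1 else 0) := by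
    intro i j hij
    simp [hB, hLbar, SimpleGraph.lapMatrix, SimpleGraph.degMatrix, hij, SimpleGraph.adjMatrix_apply]
  have hBw : B *ᵥ w = 0 := by rw [hBv, hw, sub_self]
  set u : V → ℝ := fun i => |w i| with hu
  have hle : u ⬝ᵥ (B *ᵥ u) ≤ w ⬝ᵥ (B *ᵥ w) := by
    simp only [dotProduct, Matrix.mulVec, Finset.mul_sum]
    refine Finset.sum_le_sum fun i _ => Finset.sum_le_sum fun j _ => ?_
    by_cases hij : i = j
    · subst hij
      have := abs_mul_abs_self (w i)
      simp only [hu]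
      apply le_of_eq
      linear_combination B i i * this
    · rw [hoff i j hij]
      split_ifs
      · have := le_abs_self (w i * w j)
        rw [abs_mul] at this
        simp only [hu]
        linarith
      · simp
  have hBu : B *ᵥ u = 0 := by
    rw [← hPSD.dotProduct_mulVec_zero_iff]
    apply le_antisymm
    · rw [hBw, dotProduct_zero] at hle
      simpa using hle
    · exact hPSD.dotProduct_mulVec_nonneg u
  have hnn : ∀ i, 0 ≤ u i := fun i => abs_nonneg _
  have hstep : ∀ i j, G.Adj i j → u i = 0 → u j = 0 := by
    intro i j hadj hi
    have h1 : ∑ k, B i k * u k = 0 := congrFun hBu i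
    have h2 : ∀ k ∈ Finset.univ, B i k * u k ≤ 0 := by
      intro k _
      by_cases hik : i = k
      · subst hik; simp [hi]
      · rw [hoff i k hik]
        have := hnn k
        split_ifs <;> simp [this]
    have h3 := (Finset.sum_eq_zero_iff_of_nonpos h2).1 h1 j (Finset.mem_univ _)
    rw [hoff i j hadj.ne] at h3
    simpa [hadj] using h3
  have hwalk : ∀ i j, G.Walk i j → u i = 0 → u j = 0 := by
    intro i j p
    induction p with
    | nil => exact id
    | cons h _ ih => exact fun hi => ih (hstep _ _ h hi)
  refine ⟨u, fun i => lt_of_le_of_ne (hnn i) fun h => hw0 ?_, ?_⟩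
  · ext j
    obtain ⟨p⟩ := hconn.preconnected i j
    exact abs_eq_zero.1 (hwalk i j p h.symm)
  · rw [hBv] at hBu
    exact sub_eq_zero.1 hBu
end

section
/- Let G be a finite connected simple graph on a vertex set V with at least two vertices, V_ℓ ⊆ V a set of leader nodes with follower set V_f = V \ V_ℓ, and λ ∈ (0,1). Let Â = D̂_λ^{-1} A and let v̄ be the comparison vector. Then for every follower node j ∈ V_f, |[Â v̄]_j − 1| ≤ (λ + |N(j) ∩ V_ℓ|)/(deg(j) − λ). In particular, the deviation of [Â v̄]_j from [v̄]_j = 1 tends to 0 as deg(j) grows while the number of leader neighbors of j stays bounded. -/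
open Matrix Finset

/-- For every follower node `j`, the `j`-th component of `Â v̄`
deviates from `[v̄]_j = 1` by at most `(λ + |N(j) ∩ V_ℓ|)/(deg j − λ)`. -/
theorem seminormalized_adj_comparison_vector_follower_error_bound
    {V : Type*} [Fintype V] [DecidableEq V]
    (G : SimpleGraph V) [DecidableRel G.Adj]
    (hconn : G.Connected) (hcard : 2 ≤ Fintype.card V)
    (Vl : Finset V) (lam : ℝ) (hlam0 : 0 < lam) (hlam1 : lam < 1)
    (Ahat : Matrix V V ℝ)
    (hAhat : Ahat = (Matrix.diagonal (fun i : V =>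
        (G.degree i : ℝ) + (if i ∈ Vl then (1 : ℝ) else 0) - lam))⁻¹ * G.adjMatrix ℝ)
    (vbar : V → ℝ)
    (hvbar : ∀ j, vbar j = if j ∈ Vl
        then (G.degree j : ℝ) / ((G.degree j : ℝ) + 1 - lam) else 1)
    (j : V) (hj : j ∉ Vl) :
    |(Ahat *ᵥ vbar) j - 1| ≤
      (lam + ((G.neighborFinset j ∩ Vl).card : ℝ)) / ((G.degree j : ℝ) - lam) := by
  have : Nontrivial V := Fintype.one_lt_card_iff_nontrivial.mp hcard
  have hdeg : ∀ i, (1 : ℝ) ≤ G.degree i := fun i => by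
    exact_mod_cast hconn.preconnected.degree_pos_of_nontrivial i
  have hpos : ∀ i, (G.degree i : ℝ) + (if i ∈ Vl then (1 : ℝ) else 0) - lam ≠ 0 := fun i => by
    have := hdeg i
    split_ifs <;> linarith
  have hinv : (Matrix.diagonal (fun i : V =>
        (G.degree i : ℝ) + (if i ∈ Vl then (1 : ℝ) else 0) - lam))⁻¹ =
      Matrix.diagonal (fun i : V =>
        ((G.degree i : ℝ) + (if i ∈ Vl then (1 : ℝ) else 0) - lam)⁻¹) := by
    apply Matrix.inv_eq_right_inv
    rw [Matrix.diagonal_mul_diagonal, ← Matrix.diagonal_one]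
    congr 1
    funext i
    exact mul_inv_cancel₀ (hpos i)
  have hA : (Ahat *ᵥ vbar) j =
      ((G.degree j : ℝ) - lam)⁻¹ * ∑ i ∈ G.neighborFinset j, vbar i := by
    rw [hAhat, hinv, ← Matrix.mulVec_mulVec, Matrix.mulVec_diagonal,
      SimpleGraph.adjMatrix_mulVec_apply]
    simp [hj]
  have hup : ∑ i ∈ G.neighborFinset j, vbar i ≤ (G.degree j : ℝ) := by
    have h : ∑ i ∈ G.neighborFinset j, vbar i ≤ ∑ i ∈ G.neighborFinset j, (1 : ℝ) := by
      apply Finset.sum_le_sum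
      intro i _
      have := hdeg i
      rw [hvbar]
      split_ifs
      · rw [div_le_one (by linarith)]
        linarith
      · exact le_rfl
    simpa using h
  have hlo : (G.degree j : ℝ) - ((G.neighborFinset j ∩ Vl).card : ℝ) ≤
      ∑ i ∈ G.neighborFinset j, vbar i := by
    have h : ∑ i ∈ G.neighborFinset j, ((1 : ℝ) - if i ∈ Vl then 1 else 0) ≤
        ∑ i ∈ G.neighborFinset j, vbar i := by
      apply Finset.sum_le_sum
      intro i _
      have := hdeg i
      rw [hvbar]
      split_ifs
      · rw [sub_self]
        apply div_nonneg <;> linarith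
      · simp
    rw [Finset.sum_sub_distrib, Finset.sum_ite_mem] at h
    simpa using h
  have hd : 0 < (G.degree j : ℝ) - lam := by linarith [hdeg j]
  have hc : (0 : ℝ) ≤ ((G.neighborFinset j ∩ Vl).card : ℝ) := Nat.cast_nonneg _
  have he : (Ahat *ᵥ vbar) j - 1 =
      (∑ i ∈ G.neighborFinset j, vbar i - (G.degree j - lam)) / ((G.degree j : ℝ) - lam) := by
    rw [hA]
    field_simp
  rw [he, abs_div, abs_of_pos hd]
  apply div_le_div_of_nonneg_right _ hd.le
  rw [abs_le]
  constructor <;> linarith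
end

section
/- Let (G_i)_{i ∈ ℕ} be a sequence of finite connected simple graphs, each with a designated leader set and follower set, such that: leaders are pairwise non-adjacent in every G_i; each leader's degree is a constant d (independent of i) along the sequence; and the minimum over follower nodes of the number of follower neighbors, deg_f^{(i)}, tends to infinity as i → ∞. Let λ_i ∈ (0,1) for each i, let Â_i be the semi-normalized adjacency matrix of G_i with parameter λ_i, and let v̄_i be the comparison vector of G_i with parameter λ_i. Then the maximum over follower nodes j of |[Â_i v̄_i]_j − 1| tends to 0 as i → ∞, while for every leader node j one has [Â_i v̄_i]_j = [v̄_i]_j exactly for all i. Consequently, max over all vertices j of |[Â_i v̄_i]_j − [v̄_i]_j| → 0 as i → ∞. -/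
open Matrix Finset

/-- Along a sequence of finite connected simple graphs in which leaders
are pairwise non-adjacent, the leader set has fixed size and each leader has fixed
degree `d`, and the minimum follower-follower degree tends to infinity, the maximum over
follower nodes of `|[Â_i v̄_i]_j − 1|` tends to `0`, while for every leader node
`[Â_i v̄_i]_j = [v̄_i]_j` exactly; consequently `max_j |[Â_i v̄_i]_j − [v̄_i]_j| → 0`. -/
theorem graph_sequence_comparison_vector_approx_eigenvector
    {V : ℕ → Type*} [∀ i, Fintype (V i)] [∀ i, DecidableEq (V i)]
    (G : ∀ i, SimpleGraph (V i)) [∀ i, DecidableRel (G i).Adj]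
    (Vl : ∀ i, Finset (V i))
    (hconn : ∀ i, (G i).Connected)
    (hNoLeaderAdj : ∀ i, ∀ j ∈ Vl i, ∀ k ∈ Vl i, ¬ (G i).Adj j k)
    (nl : ℕ) (hVlcard : ∀ i, (Vl i).card = nl)
    (d : ℕ) (hLeaderDeg : ∀ i, ∀ j ∈ Vl i, (G i).degree j = d)
    (hFollowerDeg : ∀ M : ℕ, ∃ N : ℕ, ∀ i ≥ N, ∀ j : V i, j ∉ Vl i →
        M ≤ ((G i).neighborFinset j \ Vl i).card)
    (lam : ℕ → ℝ) (hlam : ∀ i, 0 < lam i ∧ lam i < 1)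
    (Ahat : ∀ i, Matrix (V i) (V i) ℝ)
    (hAhat : ∀ i, Ahat i = (Matrix.diagonal (fun v : V i =>
        ((G i).degree v : ℝ) + (if v ∈ Vl i then (1 : ℝ) else 0) - lam i))⁻¹
          * (G i).adjMatrix ℝ)
    (vbar : ∀ i, V i → ℝ)
    (hvbar : ∀ i, ∀ j : V i, vbar i j = if j ∈ Vl i
        then ((G i).degree j : ℝ) / (((G i).degree j : ℝ) + 1 - lam i) else 1) :
    (∀ ε : ℝ, 0 < ε → ∃ N : ℕ, ∀ i ≥ N, ∀ j : V i, j ∉ Vl i →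
        |((Ahat i) *ᵥ (vbar i)) j - 1| < ε) ∧
    (∀ i, ∀ j ∈ Vl i, ((Ahat i) *ᵥ (vbar i)) j = vbar i j) ∧
    (∀ ε : ℝ, 0 < ε → ∃ N : ℕ, ∀ i ≥ N, ∀ j : V i,
        |((Ahat i) *ᵥ (vbar i)) j - vbar i j| < ε) := by
  have hne : ∀ i, ∀ v : V i,
      ((G i).degree v : ℝ) + (if v ∈ Vl i then (1 : ℝ) else 0) - lam i ≠ 0 := by
    intro i v h
    obtain ⟨h0, h1⟩ := hlam i
    have h2 : ((G i).degree v : ℝ) + (if v ∈ Vl i then (1 : ℝ) else 0) = lam i := by linarith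
    rw [← h2] at h0 h1
    have h3 : (((G i).degree v + (if v ∈ Vl i then 1 else 0) : ℕ) : ℝ)
        = ((G i).degree v : ℝ) + (if v ∈ Vl i then (1 : ℝ) else 0) := by
      push_cast
      rfl
    rw [← h3] at h0 h1
    have h4 : 0 < (G i).degree v + (if v ∈ Vl i then 1 else 0) := by exact_mod_cast h0
    have h5 : (G i).degree v + (if v ∈ Vl i then 1 else 0) < 1 := by exact_mod_cast h1
    omega
  have key : ∀ i, ∀ j : V i, ((Ahat i) *ᵥ (vbar i)) j =
      (((G i).degree j : ℝ) + (if j ∈ Vl i then (1 : ℝ) else 0) - lam i)⁻¹ *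
        ∑ k ∈ (G i).neighborFinset j, vbar i k := by
    intro i j
    have hinv : (Matrix.diagonal (fun v : V i =>
        ((G i).degree v : ℝ) + (if v ∈ Vl i then (1 : ℝ) else 0) - lam i))⁻¹ =
        Matrix.diagonal (fun v : V i =>
        (((G i).degree v : ℝ) + (if v ∈ Vl i then (1 : ℝ) else 0) - lam i)⁻¹) := by
      apply Matrix.inv_eq_right_inv
      rw [Matrix.diagonal_mul_diagonal, ← Matrix.diagonal_one]
      congr 1
      funext v
      exact mul_inv_cancel₀ (hne i v)
    rw [hAhat, hinv, ← Matrix.mulVec_mulVec, Matrix.mulVec_diagonal,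
      SimpleGraph.adjMatrix_mulVec_apply]
  have hle : ∀ i, ∀ k : V i, 0 ≤ vbar i k ∧ vbar i k ≤ 1 := by
    intro i k
    obtain ⟨h0, h1⟩ := hlam i
    rw [hvbar]
    split_ifs
    · have hd : (0 : ℝ) ≤ (G i).degree k := Nat.cast_nonneg _
      have hp : (0 : ℝ) < (G i).degree k + 1 - lam i := by linarith
      exact ⟨div_nonneg hd hp.le, (div_le_one hp).2 (by linarith)⟩
    · norm_num
  have h1 : ∀ ε : ℝ, 0 < ε → ∃ N : ℕ, ∀ i ≥ N, ∀ j : V i, j ∉ Vl i →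
        |((Ahat i) *ᵥ (vbar i)) j - 1| < ε := by
    intro ε hε
    obtain ⟨M, hM⟩ := exists_nat_gt (1 + (nl + 1 : ℝ) / ε)
    obtain ⟨N, hN⟩ := hFollowerDeg M
    refine ⟨N, fun i hi j hj => ?_⟩
    obtain ⟨hl0, hl1⟩ := hlam i
    have hc := hN i hi j hj
    have hcd : ((G i).neighborFinset j \ Vl i).card ≤ (G i).degree j :=
      Finset.card_le_card Finset.sdiff_subset
    have hdc : (G i).degree j ≤ ((G i).neighborFinset j \ Vl i).card + nl := by
      rw [← hVlcard i]
      exact Nat.sub_le_iff_le_add.1 (Finset.le_card_sdiff (Vl i) ((G i).neighborFinset j))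
    have hup : ∑ k ∈ (G i).neighborFinset j, vbar i k ≤ (G i).degree j := by
      have := Finset.sum_le_card_nsmul ((G i).neighborFinset j) (vbar i) 1
        (fun k _ => (hle i k).2)
      simpa using this
    have hlow : (((G i).neighborFinset j \ Vl i).card : ℝ)
        ≤ ∑ k ∈ (G i).neighborFinset j, vbar i k := by
      calc (((G i).neighborFinset j \ Vl i).card : ℝ)
          = ∑ k ∈ (G i).neighborFinset j \ Vl i, vbar i k := by
            rw [Finset.card_eq_sum_ones, Nat.cast_sum]
            refine Finset.sum_congr rfl fun k hk => ?_
            rw [hvbar, if_neg (Finset.mem_sdiff.1 hk).2, Nat.cast_one]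
        _ ≤ _ := Finset.sum_le_sum_of_subset_of_nonneg Finset.sdiff_subset
            (fun k _ _ => (hle i k).1)
    have hMd : (M : ℝ) ≤ (G i).degree j := by exact_mod_cast hc.trans hcd
    have hdc' : ((G i).degree j : ℝ) ≤ ((G i).neighborFinset j \ Vl i).card + nl := by
      exact_mod_cast hdc
    have hnl : (0 : ℝ) ≤ nl := Nat.cast_nonneg _
    have hq : (nl + 1 : ℝ) / ε < (G i).degree j - lam i := by linarith
    have hpos : (0 : ℝ) < (G i).degree j - lam i := lt_trans (by positivity) hq
    rw [div_lt_iff₀ hε] at hq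
    rw [key, if_neg hj, add_zero]
    have e : (((G i).degree j : ℝ) - lam i)⁻¹ * ∑ k ∈ (G i).neighborFinset j, vbar i k - 1
        = (∑ k ∈ (G i).neighborFinset j, vbar i k - ((G i).degree j - lam i))
          / ((G i).degree j - lam i) := by
      field_simp
    rw [e, abs_div, abs_of_pos hpos, div_lt_iff₀ hpos, abs_lt]
    constructor <;> linarith
  have h2 : ∀ i, ∀ j ∈ Vl i, ((Ahat i) *ᵥ (vbar i)) j = vbar i j := by
    intro i j hj
    have hs : ∑ k ∈ (G i).neighborFinset j, vbar i k = (G i).degree j := by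
      rw [← SimpleGraph.card_neighborFinset_eq_degree, Finset.card_eq_sum_ones, Nat.cast_sum]
      refine Finset.sum_congr rfl fun k hk => ?_
      rw [hvbar, if_neg, Nat.cast_one]
      intro hk2
      exact hNoLeaderAdj i j hj k hk2 ((SimpleGraph.mem_neighborFinset _ _ _).1 hk)
    rw [key, hs, hvbar, if_pos hj, if_pos hj, div_eq_inv_mul]
  refine ⟨h1, h2, fun ε hε => ?_⟩
  obtain ⟨N, hN⟩ := h1 ε hε
  refine ⟨N, fun i hi j => ?_⟩
  by_cases hj : j ∈ Vl i
  · rw [h2 i j hj, sub_self, abs_zero]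
    exact hε
  · have := hN i hi j hj
    rwa [hvbar i j, if_neg hj]
end
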